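/- arXiv:2104.13097 — 2 statements merged into one kernel-verified Lean document; each statement's English description precedes it below -/
import Mathlib

section
/- Let G=(V,E) be a finite simple graph on n ≥ 2 vertices and let s be a stability-weight function assigning to every edge uv ∈ E and endpoint v a positive integer s(uv,v). For v ∈ V with at least one neighbor let S(v) = max_{u∈N(v)} s(vu,v), and define s'(vu,v) = ⌊n²·s(vu,v)/S(v)⌋. Then: (i) s'(vu,v) ≤ n² for every edge uv and endpoint v; and (ii) for every cut (V₀,V₁), every i ∈ {0,1}, and every v ∈ V_i with at least one neighbor, d_{s'}(v) > 0 and |(Σ_{vu∈E, u∈V_{1−i}} s'(vu,v))/d_{s'}(v) − (Σ_{vu∈E, u∈V_{1−i}} s(vu,v))/d_s(v)| ≤ 2/n. -/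
open Finset

/-- Lowering the numerator and the denominator of a proper fraction, the numerator by no more than
the denominator, changes the fraction by at most the relative decrease of the denominator. -/
lemma abs_div_sub_div_le_relative_decrease {p q P Q : ℝ} (hp : 0 ≤ p) (hpq : p ≤ q) (hq : 0 < q)
    (hpP : p ≤ P) (h : P - p ≤ Q - q) : |p / q - P / Q| ≤ (Q - q) / Q := by
  have hQ : 0 < Q := by linarith
  have key : p / q - P / Q = (p / q * (Q - q) - (P - p)) / Q := by
    field_simp
    ring
  have h0 : 0 ≤ p / q := by positivity
  have h1 : p / q ≤ 1 := (div_le_one hq).2 hpq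
  rw [key, abs_div, abs_of_pos hQ]
  gcongr
  rw [abs_le]
  constructor <;> nlinarith

/-- Rounding down positive multiples `c * w u` of the weights to natural numbers changes the
fraction of the weight carried by a subset of `t` by at most `#t` over the scaled total. -/
lemma abs_sum_floor_div_sub_sum_div_le {ι : Type*} {r t : Finset ι} (hrt : r ⊆ t)
    (w : ι → ℝ) (m : ι → ℕ) {c : ℝ} (hc : 0 < c)
    (hle : ∀ u, (m u : ℝ) ≤ c * w u) (hlt : ∀ u, c * w u ≤ m u + 1)
    (hpos : (0 : ℝ) < ∑ u ∈ t, (m u : ℝ)) :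
    |(∑ u ∈ r, (m u : ℝ)) / (∑ u ∈ t, (m u : ℝ)) - (∑ u ∈ r, w u) / (∑ u ∈ t, w u)| ≤
      #t / ∑ u ∈ t, (m u : ℝ) := by
  have hscale : (∑ u ∈ r, w u) / (∑ u ∈ t, w u) =
      (∑ u ∈ r, c * w u) / (∑ u ∈ t, c * w u) := by
    rw [← mul_sum, ← mul_sum, mul_div_mul_left _ _ hc.ne']
  have htot : ∑ u ∈ t, (m u : ℝ) ≤ ∑ u ∈ t, c * w u := sum_le_sum fun u _ => hle u
  have herr : ∑ u ∈ t, c * w u - ∑ u ∈ t, (m u : ℝ) ≤ #t := by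
    rw [← sum_sub_distrib]
    calc ∑ u ∈ t, (c * w u - m u) ≤ ∑ _u ∈ t, (1 : ℝ) :=
          sum_le_sum fun u _ => by linarith [hlt u]
      _ = #t := by simp
  rw [hscale]
  refine (abs_div_sub_div_le_relative_decrease (sum_nonneg fun u _ => Nat.cast_nonneg _)
    (sum_le_sum_of_subset_of_nonneg hrt fun u _ _ => Nat.cast_nonneg _) hpos
    (sum_le_sum fun u _ => hle u) ?_).trans ?_
  · rw [← sum_sub_distrib, ← sum_sub_distrib]
    exact sum_le_sum_of_subset_of_nonneg hrt fun u _ _ => by linarith [hle u]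
  · exact div_le_div₀ (Nat.cast_nonneg _) herr hpos htot

/-- truncating stability-weights to `⌊n²·s(vu,v)/S(v)⌋` keeps every value at
most `n²` and changes, for every cut and every vertex, the fraction of its stability
degree that is cut by at most `2/n`. -/
theorem stmt6 {V : Type*} [Fintype V] [DecidableEq V] (G : SimpleGraph V) [DecidableRel G.Adj]
    (hn : 2 ≤ Fintype.card V)
    (s : V → V → ℕ) (hs : ∀ v u : V, G.Adj v u → 0 < s v u) :
    let n : ℕ := Fintype.card V
    let S : V → ℕ := fun v => (G.neighborFinset v).sup (fun u => s v u)
    let s' : V → V → ℕ := fun v u => n ^ 2 * s v u / S v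
    (∀ v u : V, G.Adj v u → s' v u ≤ n ^ 2) ∧
    (∀ f : V → Bool, ∀ v : V, (G.neighborFinset v).Nonempty →
      0 < ∑ u ∈ G.neighborFinset v, s' v u ∧
      |(∑ u ∈ (G.neighborFinset v).filter (fun u => f u ≠ f v), (s' v u : ℝ)) /
          (∑ u ∈ G.neighborFinset v, (s' v u : ℝ)) -
        (∑ u ∈ (G.neighborFinset v).filter (fun u => f u ≠ f v), (s v u : ℝ)) /
          (∑ u ∈ G.neighborFinset v, (s v u : ℝ))| ≤ 2 / (n : ℝ)) := by
  intro n S s'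
  have hn0 : 0 < n := by omega
  have hleS : ∀ v u, G.Adj v u → s v u ≤ S v := fun v u h =>
    le_sup (f := fun u => s v u) ((G.mem_neighborFinset v u).2 h)
  refine ⟨fun v u h => ?_, fun f v hv => ?_⟩
  · exact Nat.div_le_of_le_mul (by rw [mul_comm]; exact Nat.mul_le_mul_right _ (hleS v u h))
  · obtain ⟨x, hx, hxS⟩ := exists_mem_eq_sup _ hv (fun u => s v u)
    have hS : S v = s v x := hxS
    have hSpos : 0 < S v := hS ▸ hs v x ((G.mem_neighborFinset v x).1 hx)
    have hx' : s' v x = n ^ 2 := by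
      change n ^ 2 * s v x / S v = n ^ 2
      rw [← hS, Nat.mul_div_cancel _ hSpos]
    have htot : n ^ 2 ≤ ∑ u ∈ G.neighborFinset v, s' v u :=
      hx' ▸ single_le_sum (f := fun u => s' v u) (fun _ _ => Nat.zero_le _) hx
    have hpos : 0 < ∑ u ∈ G.neighborFinset v, s' v u := lt_of_lt_of_le (by positivity) htot
    have htotR : (n : ℝ) ^ 2 ≤ ∑ u ∈ G.neighborFinset v, (s' v u : ℝ) := by exact_mod_cast htot
    have hnR : (0 : ℝ) < n := by exact_mod_cast hn0
    have hSR : (0 : ℝ) < S v := by exact_mod_cast hSpos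
    have hcard : (#(G.neighborFinset v) : ℝ) ≤ n := by exact_mod_cast card_le_univ _
    have hscale : ∀ u, (n : ℝ) ^ 2 / S v * s v u = ((n ^ 2 * s v u : ℕ) : ℝ) / S v := fun u => by
      push_cast
      ring
    refine ⟨hpos, (abs_sum_floor_div_sub_sum_div_le (filter_subset _ _) (fun u => (s v u : ℝ))
      (s' v) (c := (n : ℝ) ^ 2 / S v) (by positivity) (fun u => ?_) (fun u => ?_)
      (by exact_mod_cast hpos)).trans ?_⟩
    · rw [hscale]
      exact Nat.cast_div_le
    · rw [hscale, div_le_iff₀ hSR]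
      exact_mod_cast (Nat.lt_mul_of_div_lt (Nat.lt_succ_self (s' v u)) hSpos).le
    · calc (#(G.neighborFinset v) : ℝ) / ∑ u ∈ G.neighborFinset v, (s' v u : ℝ)
          ≤ n / (n : ℝ) ^ 2 := div_le_div₀ hnR.le hcard (by positivity) htotR
        _ = 1 / n := by field_simp
        _ ≤ 2 / n := by gcongr; norm_num
end

section
/- Let δ be a positive integer and let p be a vertex of an edge-weighted simple graph whose neighborhood consists of 2δ distinct vertices a₀,…,a_{δ−1}, b₀,…,b_{δ−1}, where for each 0 ≤ ℓ ≤ δ−1 the edges p a_ℓ and p b_ℓ both have weight 2^ℓ. If (V₀,V₁) is a cut in which the total weight of cut edges incident to p equals exactly half of d_w(p) (i.e. the neighborhood of p is perfectly balanced), then for every 0 ≤ ℓ ≤ δ−1 the vertices a_ℓ and b_ℓ lie on different sides of the cut. -/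
open Finset

/-- The Bool-valued predicate telling whether an edge (unordered pair) is cut
by the two-sided partition `f`. -/
def cutP {V : Type*} (f : V → Bool) : Sym2 V → Bool :=
  Sym2.lift ⟨fun a b => xor (f a) (f b), fun a b => Bool.xor_comm _ _⟩

/-- The total weight of the cut edges of the cut `f`. -/
def cutWeight {V : Type*} [Fintype V] [DecidableEq V] (G : SimpleGraph V) [DecidableRel G.Adj]
    (w : Sym2 V → ℕ) (f : V → Bool) : ℕ :=
  ∑ e ∈ G.edgeFinset.filter (fun e => cutP f e = true), w e

/-- The weighted degree of a vertex. -/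
def wdeg {V : Type*} [Fintype V] [DecidableEq V] (G : SimpleGraph V) [DecidableRel G.Adj]
    (w : Sym2 V → ℕ) (v : V) : ℕ :=
  ∑ u ∈ G.neighborFinset v, w s(v, u)

/-- A cut `f` is stable at `v` if the total weight of cut edges incident to `v`
is at least half of the weighted degree of `v`. -/
def StableAt {V : Type*} [Fintype V] [DecidableEq V] (G : SimpleGraph V) [DecidableRel G.Adj]
    (w : Sym2 V → ℕ) (f : V → Bool) (v : V) : Prop :=
  wdeg G w v ≤ 2 * ∑ u ∈ (G.neighborFinset v).filter (fun u => f u ≠ f v), w s(v, u)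

/-- A cut is stable if it is stable at every vertex. -/
def IsStableCut {V : Type*} [Fintype V] [DecidableEq V] (G : SimpleGraph V) [DecidableRel G.Adj]
    (w : Sym2 V → ℕ) (f : V → Bool) : Prop :=
  ∀ v : V, StableAt G w f v

/-- The only representation of `2 ^ n - 1 = ∑ i < n, 2 ^ i` with digits `0, 1, 2` in base two is the
one with all digits equal to one. -/
theorem eq_one_of_sum_mul_two_pow_eq {n : ℕ} (c : Fin n → ℕ) (hc : ∀ i, c i ≤ 2)
    (h : ∑ i, c i * 2 ^ i.val = ∑ i : Fin n, 2 ^ i.val) (i : Fin n) : c i = 1 := by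
  induction n with
  | zero => exact i.elim0
  | succ n ih =>
    simp only [Fin.sum_univ_succ, Fin.val_zero, pow_zero, mul_one, Fin.val_succ, pow_succ,
      ← mul_assoc, ← Finset.sum_mul] at h
    have h0 := hc 0
    have hzero : c 0 = 1 := by omega
    refine Fin.cases hzero (fun j => ?_) i
    exact ih (fun j => c j.succ) (fun j => hc j.succ) (by omega) j

/-- if the neighborhood of `p` consists of `2δ` distinct vertices
`a₀,…,a_{δ−1}, b₀,…,b_{δ−1}` where the edges `p aₗ` and `p bₗ` both have weight `2^ℓ`,
then in any cut whose cut edges at `p` have total weight exactly half of `d_w(p)`,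
the vertices `aₗ` and `bₗ` lie on different sides, for every `ℓ`. -/
theorem stmt14 {V : Type*} [Fintype V] [DecidableEq V] (G : SimpleGraph V) [DecidableRel G.Adj]
    (w : Sym2 V → ℕ) (δ : ℕ) (hδ : 0 < δ) (p : V) (a b : Fin δ → V)
    (ha : Function.Injective a) (hb : Function.Injective b)
    (hab : ∀ ℓ ℓ' : Fin δ, a ℓ ≠ b ℓ')
    (hN : G.neighborFinset p = Finset.image a Finset.univ ∪ Finset.image b Finset.univ)
    (hwa : ∀ ℓ : Fin δ, w s(p, a ℓ) = 2 ^ ℓ.val)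
    (hwb : ∀ ℓ : Fin δ, w s(p, b ℓ) = 2 ^ ℓ.val)
    (f : V → Bool)
    (hbal : 2 * ∑ u ∈ (G.neighborFinset p).filter (fun u => f u ≠ f p), w s(p, u)
              = wdeg G w p) :
    ∀ ℓ : Fin δ, f (a ℓ) ≠ f (b ℓ) := by
  have hdisj : Disjoint (Finset.image a Finset.univ) (Finset.image b Finset.univ) := by
    simp only [Finset.disjoint_left, Finset.mem_image, Finset.mem_univ, true_and]
    rintro _ ⟨i, rfl⟩ ⟨j, hj⟩
    exact hab i j hj.symm
  have hsum (g : V → ℕ) : ∑ u ∈ G.neighborFinset p, g u = ∑ i, (g (a i) + g (b i)) := by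
    rw [hN, Finset.sum_union hdisj, Finset.sum_image ha.injOn, Finset.sum_image hb.injOn,
      Finset.sum_add_distrib]
  rw [Finset.sum_filter, wdeg, hsum, hsum] at hbal
  simp only [hwa, hwb, ← two_mul, ← Finset.mul_sum] at hbal
  intro ℓ hℓ
  have key := eq_one_of_sum_mul_two_pow_eq
    (fun i => (if f (a i) ≠ f p then 1 else 0) + (if f (b i) ≠ f p then 1 else 0))
    (fun i => by split_ifs <;> omega)
    (by
      simp only [add_mul, ite_mul, one_mul, zero_mul]
      omega) ℓ
  simp only [hℓ] at key
  split_ifs at key <;> omega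
end
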